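/- arXiv:1710.03455 — 8 statements merged into one kernel-verified Lean document; each statement's English description precedes it below -/
import Mathlib

section
/- Let n ≥ 2 and let 𝒩 be a real n×n matrix. Then 𝒩 is similar over ℝ to a connected undirected graph Laplacian matrix (i.e., there exists an invertible real matrix S such that S⁻¹ 𝒩 S is a connected undirected graph Laplacian) if and only if 𝒩 is diagonalizable over ℝ with exactly one zero eigenvalue and all its other eigenvalues real and positive; that is, if and only if there exist an invertible real matrix T and a diagonal real matrix D whose diagonal entries are λ₁, …, λ_{n−1}, 0 with λᵢ > 0 for all i, such that 𝒩 = T D T⁻¹. -/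
open Matrix

/-- A matrix `L` is a connected undirected graph Laplacian if it is symmetric, has
nonpositive off-diagonal entries, zero row sums, is positive semidefinite, and its
kernel is spanned by the all-ones vector (i.e. `0` is a simple eigenvalue). -/
def IsConnLaplacian {N : ℕ} (L : Matrix (Fin N) (Fin N) ℝ) : Prop :=
  L.IsSymm ∧ (∀ i j, i ≠ j → L i j ≤ 0) ∧ (L *ᵥ (fun _ => (1 : ℝ)) = 0) ∧
    L.PosSemidef ∧ ∀ v : Fin N → ℝ, L *ᵥ v = 0 → ∃ c : ℝ, v = fun _ => c

/-- Column `k` of the (unnormalised) Helmert matrix: `k + 1` ones followed by `-(k + 1)`. -/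
def helmert (k i : ℕ) : ℝ :=
  if i ≤ k then 1 else if i = k + 1 then -((k : ℝ) + 1) else 0

lemma helmert_of_le {k i : ℕ} (h : i ≤ k) : helmert k i = 1 := if_pos h

lemma helmert_succ (k : ℕ) : helmert k (k + 1) = -((k : ℝ) + 1) := by
  simp [helmert]

lemma helmert_of_lt {k i : ℕ} (h : k + 1 < i) : helmert k i = 0 := by
  rw [helmert, if_neg (by omega), if_neg (by omega)]

lemma sum_range_helmert_of_lt {k N : ℕ} (h : k + 1 < N) :
    ∑ i ∈ Finset.range N, helmert k i = 0 := by
  induction N, h using Nat.le_induction with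
  | base =>
    rw [Finset.sum_range_succ, helmert_succ,
      Finset.sum_congr rfl fun i hi => helmert_of_le (by simpa [Nat.lt_succ_iff] using hi)]
    simp
  | succ N hN ih =>
    rw [Finset.sum_range_succ, ih, helmert_of_lt hN, add_zero]

lemma sum_range_helmert_sq_of_lt {k N : ℕ} (h : k + 1 < N) :
    ∑ i ∈ Finset.range N, helmert k i * helmert k i = ((k : ℝ) + 1) * (k + 2) := by
  induction N, h using Nat.le_induction with
  | base =>
    rw [Finset.sum_range_succ, helmert_succ, Finset.sum_congr rfl fun i hi => by
      rw [helmert_of_le (show i ≤ k by simpa [Nat.lt_succ_iff] using hi)]]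
    simp
    ring
  | succ N hN ih =>
    rw [Finset.sum_range_succ, ih, helmert_of_lt hN, mul_zero, add_zero]

lemma sum_range_helmert_mul_helmert {k l N : ℕ} (hkl : k < l) (hl : l < N) :
    ∑ i ∈ Finset.range N, helmert k i * helmert l i = 0 := by
  rw [← sum_range_helmert_of_lt (show k + 1 < N by omega)]
  refine Finset.sum_congr rfl fun i _ => ?_
  rcases le_or_gt i l with h | h
  · rw [helmert_of_le h, mul_one]
  · rw [helmert_of_lt (show k + 1 < i by omega), zero_mul]

lemma sum_range_weighted_helmert_le {g : ℕ → ℝ} (hg : Antitone g) {i p N : ℕ}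
    (hi : i ≤ p) (hN : p + 1 ≤ N) :
    ∑ k ∈ Finset.range N, helmert k i * (g k / (((k : ℝ) + 1) * (k + 2))) * helmert k (p + 1) ≤
      -g p / (N + 1) := by
  induction N, hN using Nat.le_induction with
  | base =>
    rw [Finset.sum_range_succ, Finset.sum_eq_zero, helmert_of_le hi, helmert_succ]
    · refine le_of_eq ?_
      push_cast
      field_simp
      ring
    · intro k hk
      rw [helmert_of_lt (show k + 1 < p + 1 by simpa using hk), mul_zero]
  | succ N hN ih =>
    rw [Finset.sum_range_succ, helmert_of_le (show i ≤ N by omega), helmert_of_le hN]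
    have h : g N / (((N : ℝ) + 1) * (N + 2)) ≤ g p / (((N : ℝ) + 1) * (N + 2)) := by
      gcongr
      exact hg (by omega)
    calc _ ≤ -g p / (N + 1) + g p / (((N : ℝ) + 1) * (N + 2)) := by linarith
      _ = _ := by
        push_cast
        field_simp
        ring

/-- The `n × n` matrix with orthogonal columns `helmert 0, …, helmert (n - 1)`. -/
def helmertMatrix (n : ℕ) : Matrix (Fin n) (Fin n) ℝ :=
  Matrix.of fun i k => helmert k i

/-- The squared norms of the columns of `helmertMatrix n`. -/
def helmertNormSq (n : ℕ) (k : Fin n) : ℝ :=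
  ∑ i ∈ Finset.range n, helmert k i * helmert k i

lemma helmertNormSq_pos {n : ℕ} (k : Fin n) : 0 < helmertNormSq n k :=
  Finset.sum_pos' (fun _ _ => mul_self_nonneg _)
    ⟨k, by simp, by rw [helmert_of_le le_rfl]; norm_num⟩

lemma helmertMatrix_transpose_mul_self (n : ℕ) :
    (helmertMatrix n)ᵀ * helmertMatrix n = diagonal (helmertNormSq n) := by
  ext k l
  have h : ((helmertMatrix n)ᵀ * helmertMatrix n) k l =
      ∑ i ∈ Finset.range n, helmert k i * helmert l i := by
    rw [Finset.sum_range]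
    rfl
  rw [h]
  rcases lt_trichotomy k l with hkl | rfl | hkl
  · rw [sum_range_helmert_mul_helmert hkl l.2, diagonal_apply_ne _ hkl.ne]
  · rw [diagonal_apply_eq, helmertNormSq]
  · rw [diagonal_apply_ne _ hkl.ne', ← sum_range_helmert_mul_helmert hkl k.2]
    exact Finset.sum_congr rfl fun _ _ => mul_comm _ _

lemma helmertMatrix_left_inverse (n : ℕ) :
    (diagonal (helmertNormSq n)⁻¹ * (helmertMatrix n)ᵀ) * helmertMatrix n = 1 := by
  rw [Matrix.mul_assoc, helmertMatrix_transpose_mul_self, diagonal_mul_diagonal, ← diagonal_one]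
  congr 1
  ext k
  exact inv_mul_cancel₀ (helmertNormSq_pos k).ne'

lemma isUnit_helmertMatrix (n : ℕ) : IsUnit (helmertMatrix n) :=
  IsUnit.of_mul_eq_one_right _ (helmertMatrix_left_inverse n)

lemma helmertMatrix_conj_diagonal {n : ℕ} (e : Fin n → ℝ) :
    helmertMatrix n * diagonal e * (helmertMatrix n)⁻¹ =
      helmertMatrix n * diagonal (fun k => e k / helmertNormSq n k) * (helmertMatrix n)ᵀ := by
  rw [inv_eq_left_inv (helmertMatrix_left_inverse n), ← Matrix.mul_assoc,
    Matrix.mul_assoc (helmertMatrix n), diagonal_mul_diagonal]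
  rfl

lemma helmertMatrix_conj_diagonal_apply {n : ℕ} (e : Fin n → ℝ) (i j : Fin n) :
    (helmertMatrix n * diagonal e * (helmertMatrix n)⁻¹) i j =
      ∑ k : Fin n, helmert k i * (e k / helmertNormSq n k) * helmert k j := by
  rw [helmertMatrix_conj_diagonal, mul_apply]
  simp only [mul_diagonal]
  rfl

lemma helmertMatrix_conj_diagonal_isSymm {n : ℕ} (e : Fin n → ℝ) :
    (helmertMatrix n * diagonal e * (helmertMatrix n)⁻¹).IsSymm := by
  rw [helmertMatrix_conj_diagonal, IsSymm]
  simp [Matrix.mul_assoc]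

lemma helmertMatrix_conj_diagonal_apply_nonpos {m : ℕ} {e : Fin (m + 1) → ℝ}
    (he : Antitone e) (hlast : e (Fin.last m) = 0) {i j : Fin (m + 1)} (hij : i < j) :
    (helmertMatrix (m + 1) * diagonal e * (helmertMatrix (m + 1))⁻¹) i j ≤ 0 := by
  set g : ℕ → ℝ := fun k => e ⟨min k m, by omega⟩ with hg
  have hg_anti : Antitone g := fun a b hab => he (by
    rw [Fin.mk_le_mk]
    omega)
  have hg_eq (k : Fin (m + 1)) : g k = e k := by
    rw [hg]
    exact congrArg e (Fin.ext (min_eq_left k.is_le))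
  obtain ⟨p, hp⟩ : ∃ p, (j : ℕ) = p + 1 := ⟨j - 1, by have := Fin.lt_def.1 hij; omega⟩
  have hip : (i : ℕ) ≤ p := by have := Fin.lt_def.1 hij; omega
  have key := sum_range_weighted_helmert_le hg_anti hip (show p + 1 ≤ m + 1 by omega)
  have hp_nonneg : 0 ≤ g p := hlast ▸ he (Fin.le_last _)
  rw [helmertMatrix_conj_diagonal_apply]
  refine le_trans (le_of_eq ?_) (key.trans
    (div_nonpos_of_nonpos_of_nonneg (neg_nonpos.2 hp_nonneg) (by positivity)))
  rw [Finset.sum_range]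
  refine Finset.sum_congr rfl fun k _ => ?_
  rw [hg_eq, hp]
  rcases eq_or_ne k (Fin.last m) with rfl | hk
  · simp [hlast]
  · have : (k : ℕ) < m := Fin.val_lt_last hk
    rw [helmertNormSq, sum_range_helmert_sq_of_lt (by omega)]

lemma helmertMatrix_mulVec_single_last (m : ℕ) (c : ℝ) :
    helmertMatrix (m + 1) *ᵥ Pi.single (Fin.last m) c = fun _ => c := by
  ext i
  rw [mulVec_single]
  simp [helmertMatrix, helmert_of_le (Fin.is_le i)]

lemma isConnLaplacian_helmertMatrix_conj_diagonal {m : ℕ} {e : Fin (m + 1) → ℝ}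
    (he : Antitone e) (hlast : e (Fin.last m) = 0) (hpos : ∀ k, k ≠ Fin.last m → 0 < e k) :
    IsConnLaplacian (helmertMatrix (m + 1) * diagonal e * (helmertMatrix (m + 1))⁻¹) := by
  have hdet := (isUnit_iff_isUnit_det _).1 (isUnit_helmertMatrix (m + 1))
  refine ⟨helmertMatrix_conj_diagonal_isSymm e, fun i j hij => ?_, ?_, ?_, fun v hv => ?_⟩
  · rcases hij.lt_or_gt with h | h
    · exact helmertMatrix_conj_diagonal_apply_nonpos he hlast h
    · rw [← (helmertMatrix_conj_diagonal_isSymm e).apply i j]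
      exact helmertMatrix_conj_diagonal_apply_nonpos he hlast h
  · rw [← helmertMatrix_mulVec_single_last, mulVec_mulVec, Matrix.mul_assoc, nonsing_inv_mul _ hdet,
      Matrix.mul_one, ← mulVec_mulVec, diagonal_mulVec_single, hlast]
    simp
  · rw [helmertMatrix_conj_diagonal, ← conjTranspose_eq_transpose_of_trivial]
    refine PosSemidef.mul_mul_conjTranspose_same (PosSemidef.diagonal fun k => ?_) _
    exact div_nonneg (hlast ▸ he (Fin.le_last k)) (helmertNormSq_pos k).le
  · set y := (helmertMatrix (m + 1))⁻¹ *ᵥ v with hy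
    have hv_eq : v = helmertMatrix (m + 1) *ᵥ y := by
      rw [hy, mulVec_mulVec, mul_nonsing_inv _ hdet, one_mulVec]
    have hDy : diagonal e *ᵥ y = 0 := by
      apply mulVec_injective_of_isUnit (isUnit_helmertMatrix (m + 1))
      simpa [hy, mulVec_mulVec, Matrix.mul_assoc] using hv
    refine ⟨y (Fin.last m), ?_⟩
    rw [← helmertMatrix_mulVec_single_last, hv_eq]
    congr 1
    ext k
    rcases eq_or_ne k (Fin.last m) with rfl | hk
    · simp
    · have h := congrFun hDy k
      rw [mulVec_diagonal, Pi.zero_apply] at h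
      rw [Pi.single_eq_of_ne hk]
      exact (mul_eq_zero.1 h).resolve_left (hpos k hk).ne'

lemma exists_isConnLaplacian_conj_diagonal {n : ℕ} {d : Fin n → ℝ}
    (hzero : ∃! i, d i = 0) (hd : ∀ i, d i = 0 ∨ 0 < d i) :
    ∃ U : Matrix (Fin n) (Fin n) ℝ, IsUnit U ∧ IsConnLaplacian (U * diagonal d * U⁻¹) := by
  obtain ⟨i₀, hi₀, huniq⟩ := hzero
  obtain ⟨m, rfl⟩ : ∃ m, n = m + 1 := ⟨n - 1, by have := i₀.2; omega⟩
  set σ := Tuple.sort (-d)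
  have he : Antitone (d ∘ σ) := fun a b hab =>
    neg_le_neg_iff.1 (Tuple.monotone_sort (-d) hab)
  have hnonneg i : 0 ≤ d i := (hd i).elim (fun h => h.ge) le_of_lt
  have hlast : (d ∘ σ) (Fin.last m) = 0 := by
    refine le_antisymm ?_ (hnonneg _)
    have h := he (Fin.le_last (σ.symm i₀))
    simpa [hi₀] using h
  have hpos k (hk : k ≠ Fin.last m) : 0 < (d ∘ σ) k :=
    (hd (σ k)).resolve_left fun h =>
      hk (σ.injective ((huniq _ h).trans (huniq _ hlast).symm))
  have hdiag : diagonal d = (diagonal (d ∘ σ)).submatrix σ.symm σ.symm := by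
    rw [submatrix_diagonal_equiv]
    congr 1
    ext
    simp
  refine ⟨(helmertMatrix (m + 1)).submatrix (Equiv.refl _) σ.symm,
    (isUnit_submatrix_equiv _ _).2 (isUnit_helmertMatrix _), ?_⟩
  rw [inv_submatrix_equiv, hdiag, submatrix_mul_equiv, submatrix_mul_equiv]
  exact isConnLaplacian_helmertMatrix_conj_diagonal he hlast hpos

lemma IsConnLaplacian.exists_eq_conj_diagonal {n : ℕ} [NeZero n] {L : Matrix (Fin n) (Fin n) ℝ}
    (hL : IsConnLaplacian L) :
    ∃ (U : Matrix (Fin n) (Fin n) ℝ) (d : Fin n → ℝ), IsUnit U ∧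
      (∃! i : Fin n, d i = 0) ∧ (∀ i : Fin n, d i = 0 ∨ 0 < d i) ∧
      L = U * diagonal d * U⁻¹ := by
  obtain ⟨-, -, hone, hpsd, hker⟩ := hL
  set U : Matrix (Fin n) (Fin n) ℝ := ↑hpsd.1.eigenvectorUnitary
  set d := hpsd.1.eigenvalues
  have hUinv : star U * U = 1 := Unitary.coe_star_mul_self hpsd.1.eigenvectorUnitary
  have hunit : IsUnit U := IsUnit.of_mul_eq_one_right _ hUinv
  have hdet := (isUnit_iff_isUnit_det _).1 hunit
  have hspec : L = U * diagonal d * U⁻¹ := by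
    rw [inv_eq_left_inv hUinv]
    have h := hpsd.1.spectral_theorem
    rw [Unitary.conjStarAlgAut_apply] at h
    exact h
  have hLU : L * U = U * diagonal d := by
    rw [hspec, Matrix.mul_assoc, nonsing_inv_mul _ hdet, Matrix.mul_one]
  have hinj := mulVec_injective_of_isUnit hunit
  refine ⟨U, d, hunit, existsUnique_of_exists_of_unique ?_ fun i j hi hj => ?_,
    fun i => (hpsd.eigenvalues_nonneg i).eq_or_lt.imp_left Eq.symm, hspec⟩
  · by_contra! hne
    have hDy : diagonal d *ᵥ (U⁻¹ *ᵥ fun _ => (1 : ℝ)) = 0 := by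
      apply hinj
      rw [mulVec_mulVec, mulVec_mulVec, ← hspec, hone, mulVec_zero]
    have hy : (U⁻¹ *ᵥ fun _ => (1 : ℝ)) = 0 := by
      ext k
      have h := congrFun hDy k
      rw [mulVec_diagonal] at h
      exact (mul_eq_zero.1 h).resolve_left (hne k)
    have h := congrArg (U *ᵥ ·) hy
    simp only [mulVec_mulVec, mul_nonsing_inv _ hdet, one_mulVec, mulVec_zero] at h
    exact one_ne_zero (congrFun h 0)
  · have hconst k (hk : d k = 0) : ∃ c : ℝ, U *ᵥ Pi.single k 1 = fun _ => c := by
      apply hker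
      rw [mulVec_mulVec, hLU, ← mulVec_mulVec, diagonal_mulVec_single, hk]
      simp
    obtain ⟨a, ha⟩ := hconst i hi
    obtain ⟨b, hb⟩ := hconst j hj
    by_contra hij
    have h : (b • Pi.single i 1 : Fin n → ℝ) = a • Pi.single j 1 := by
      apply hinj
      rw [mulVec_smul, mulVec_smul, ha, hb]
      ext
      simp [mul_comm]
    have hb0 : b = 0 := by simpa [hij] using congrFun h i
    have hz : (Pi.single j 1 : Fin n → ℝ) = 0 := by
      apply hinj
      rw [hb, hb0, mulVec_zero]
      rfl
    simpa using congrFun hz j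

theorem laplacian_similarity_characterization {n : ℕ} (hn : 2 ≤ n)
    (𝒩 : Matrix (Fin n) (Fin n) ℝ) :
    (∃ S : Matrix (Fin n) (Fin n) ℝ, IsUnit S ∧ IsConnLaplacian (S⁻¹ * 𝒩 * S)) ↔
    (∃ (T : Matrix (Fin n) (Fin n) ℝ) (d : Fin n → ℝ), IsUnit T ∧
      (∃! i : Fin n, d i = 0) ∧ (∀ i : Fin n, d i = 0 ∨ 0 < d i) ∧
      𝒩 = T * Matrix.diagonal d * T⁻¹) := by
  have : NeZero n := ⟨by omega⟩
  constructor
  · rintro ⟨S, hS, hL⟩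
    obtain ⟨U, d, hU, hzero, hd, h⟩ := hL.exists_eq_conj_diagonal
    have hdet := (isUnit_iff_isUnit_det _).1 hS
    refine ⟨S * U, d, hS.mul hU, hzero, hd, ?_⟩
    calc 𝒩 = S * (S⁻¹ * 𝒩 * S) * S⁻¹ := by
          simp [Matrix.mul_assoc, mul_nonsing_inv_cancel_left _ _ hdet, mul_nonsing_inv _ hdet]
      _ = _ := by
          rw [h, Matrix.mul_inv_rev]
          simp only [Matrix.mul_assoc]
  · rintro ⟨T, d, hT, hzero, hd, rfl⟩
    obtain ⟨U, hU, hL⟩ := exists_isConnLaplacian_conj_diagonal hzero hd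
    have hdetT := (isUnit_iff_isUnit_det _).1 hT
    have hdetU := (isUnit_iff_isUnit_det _).1 hU
    refine ⟨T * U⁻¹, hT.mul ((isUnit_nonsing_inv_iff).2 hU), ?_⟩
    convert hL using 1
    rw [Matrix.mul_inv_rev, nonsing_inv_nonsing_inv _ hdetU]
    simp only [Matrix.mul_assoc, nonsing_inv_mul_cancel_left _ _ hdetT]
end

section
/- Let n ≥ 2 and let λ₁ ≥ λ₂ ≥ ⋯ ≥ λ_{n−1} > 0 be real numbers. Define recursively S₀ = 0 and, for l = 1, 2, …, n−1, a_l = (λ_{n−l} − S_{l−1})/(n − l + 1) and S_l = S_{l−1} + a_l. Then for every l ∈ {1, …, n−1}: (i) a_l > 0, and (ii) l·λ_{n−1}/n ≤ S_l ≤ l·λ_{n−l}/n. -/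
/-- One step of the weight recursion preserves the two-sided linear bounds on the partial sum. -/
theorem weights_recursion_step {N m μ ν s : ℝ} (hm : 0 ≤ m) (hmN : m + 1 ≤ N)
    (hν : 0 < ν) (hνμ : ν ≤ μ) (hl : m * ν / N ≤ s) (hu : s ≤ m * μ / N) :
    0 < (μ - s) / (N - m) ∧ (m + 1) * ν / N ≤ s + (μ - s) / (N - m) ∧
      s + (μ - s) / (N - m) ≤ (m + 1) * μ / N := by
  have hN : 0 < N := by linarith
  have hd : 0 < N - m := by linarith
  have hN0 : N ≠ 0 := hN.ne'
  have hd0 : N - m ≠ 0 := hd.ne'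
  have hμ : 0 < μ := hν.trans_le hνμ
  have hr : 0 ≤ (N - m - 1) / (N - m) := div_nonneg (by linarith) hd.le
  refine ⟨?_, ?_, ?_⟩
  · have h : m * μ / N < μ := by
      rw [div_lt_iff₀ hN]
      nlinarith
    exact div_pos (by linarith) hd
  · have h : s + (μ - s) / (N - m) - (m + 1) * ν / N =
        (N - m - 1) / (N - m) * (s - m * ν / N) + (μ - ν) / (N - m) := by
      field_simp
      ring
    have h₁ := mul_nonneg hr (sub_nonneg.2 hl)
    have h₂ := div_nonneg (sub_nonneg.2 hνμ) hd.le
    linarith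
  · have h : (m + 1) * μ / N - (s + (μ - s) / (N - m)) =
        (N - m - 1) / (N - m) * (m * μ / N - s) := by
      field_simp
      ring
    have h₁ := mul_nonneg hr (sub_nonneg.2 hu)
    linarith

theorem weights_recursion_positive {n : ℕ} (hn : 2 ≤ n) (lam : ℕ → ℝ)
    (hmono : ∀ i j : ℕ, 1 ≤ i → i ≤ j → j ≤ n - 1 → lam j ≤ lam i)
    (hpos : 0 < lam (n - 1))
    (a S : ℕ → ℝ) (hS0 : S 0 = 0)
    (ha : ∀ l : ℕ, 1 ≤ l → l ≤ n - 1 →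
      a l = (lam (n - l) - S (l - 1)) / ((n : ℝ) - (l : ℝ) + 1))
    (hSrec : ∀ l : ℕ, 1 ≤ l → l ≤ n - 1 → S l = S (l - 1) + a l) :
    ∀ l : ℕ, 1 ≤ l → l ≤ n - 1 →
      0 < a l ∧ (l : ℝ) * lam (n - 1) / (n : ℝ) ≤ S l ∧
        S l ≤ (l : ℝ) * lam (n - l) / (n : ℝ) := by
  intro l hl
  induction l, hl using Nat.le_induction with
  | base =>
    intro h
    have hstep := weights_recursion_step (N := n) (m := 0) (s := 0) le_rfl
      (by norm_cast; omega) hpos le_rfl (by simp) (by simp)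
    rw [hSrec 1 le_rfl h, ha 1 le_rfl h]
    simpa [hS0] using hstep
  | succ m hm ih =>
    intro h
    obtain ⟨-, hlow, hup⟩ := ih (by omega)
    have hup' : S m ≤ m * lam (n - (m + 1)) / n := hup.trans <| by
      gcongr
      exact hmono _ _ (by omega) (by omega) (by omega)
    have hstep := weights_recursion_step (N := n) m.cast_nonneg
      (by norm_cast; omega) hpos (hmono (n - (m + 1)) (n - 1) (by omega) (by omega) le_rfl)
      hlow hup'
    have hden : (n : ℝ) - ((m + 1 : ℕ) : ℝ) + 1 = n - m := by
      push_cast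
      ring
    rw [hSrec (m + 1) (by omega) h, ha (m + 1) (by omega) h, hden, Nat.add_sub_cancel]
    exact_mod_cast hstep
end

section
/- Let A ∈ ℝ^{n×n}, B ∈ ℝ^{n×m}, and let K ∈ ℝ^{n×n} be symmetric positive definite such that AᵀK + KA is negative semidefinite, and set C = BᵀK ∈ ℝ^{m×n}. Let Λ ∈ ℝ^{(N−1)×(N−1)} be a diagonal matrix with positive diagonal entries, let F ∈ ℝ^{(N−1)×p}, and let X ∈ ℝ^{(N−1)×(N−1)} be symmetric positive semidefinite with ΛX + XΛ = FFᵀ. Define Φ = I_{N−1} ⊗ A − Λ ⊗ (BC). Then the matrix Φ(X ⊗ K⁻¹) + (X ⊗ K⁻¹)Φᵀ + (FFᵀ) ⊗ (BBᵀ) is negative semidefinite; that is, X ⊗ K⁻¹ is a generalized controllability Gramian of the system (Φ, F ⊗ B). -/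
open Matrix Kronecker

/-- The dissipation inequality for a storage matrix `K`, in dual form: `A * K⁻¹ + K⁻¹ * Aᵀ` is
negative semidefinite. -/
theorem posSemidef_neg_mul_inv_add_inv_mul_transpose {ι : Type*} [Fintype ι] [DecidableEq ι]
    {A K : Matrix ι ι ℝ} (hK : K.PosDef) (h : (-(Aᵀ * K + K * A)).PosSemidef) :
    (-(A * K⁻¹ + K⁻¹ * Aᵀ)).PosSemidef := by
  have hdet : IsUnit K.det := K.isUnit_iff_isUnit_det.mp hK.isUnit
  have hcongr := h.conjTranspose_mul_mul_same K⁻¹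
  rw [hK.inv.isHermitian.eq] at hcongr
  convert hcongr using 1
  have h₁ : K⁻¹ * (Aᵀ * K) * K⁻¹ = K⁻¹ * Aᵀ := by
    rw [← Matrix.mul_assoc, mul_nonsing_inv_cancel_right _ _ hdet]
  have h₂ : K⁻¹ * (K * A) * K⁻¹ = A * K⁻¹ := by
    rw [nonsing_inv_mul_cancel_left _ _ hdet]
  rw [Matrix.mul_neg, Matrix.neg_mul, Matrix.mul_add, Matrix.add_mul, h₁, h₂, add_comm]

theorem generalized_controllability_gramian {n m N p : ℕ}
    (A : Matrix (Fin n) (Fin n) ℝ) (B : Matrix (Fin n) (Fin m) ℝ)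
    (K : Matrix (Fin n) (Fin n) ℝ) (hK : K.PosDef)
    (hKYP : (-(Aᵀ * K + K * A)).PosSemidef)
    (C : Matrix (Fin m) (Fin n) ℝ) (hC : C = Bᵀ * K)
    (d : Fin (N - 1) → ℝ) (hd : ∀ i, 0 < d i)
    (F : Matrix (Fin (N - 1)) (Fin p) ℝ)
    (X : Matrix (Fin (N - 1)) (Fin (N - 1)) ℝ) (hX : X.PosSemidef)
    (hXeq : Matrix.diagonal d * X + X * Matrix.diagonal d = F * Fᵀ) :
    (-(((1 : Matrix (Fin (N - 1)) (Fin (N - 1)) ℝ) ⊗ₖ A - Matrix.diagonal d ⊗ₖ (B * C)) *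
          (X ⊗ₖ K⁻¹) +
        (X ⊗ₖ K⁻¹) *
          ((1 : Matrix (Fin (N - 1)) (Fin (N - 1)) ℝ) ⊗ₖ A - Matrix.diagonal d ⊗ₖ (B * C))ᵀ +
        (F * Fᵀ) ⊗ₖ (B * Bᵀ))).PosSemidef := by
  have hdet : IsUnit K.det := K.isUnit_iff_isUnit_det.mp hK.isUnit
  have hKt : Kᵀ = K := by simpa using hK.isHermitian.eq
  have hBC : B * C * K⁻¹ = B * Bᵀ := by
    rw [hC, ← Matrix.mul_assoc, mul_nonsing_inv_cancel_right _ _ hdet]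
  have hBCt : K⁻¹ * (B * C)ᵀ = B * Bᵀ := by
    rw [hC, ← Matrix.mul_assoc, transpose_mul, hKt, nonsing_inv_mul_cancel_left _ _ hdet,
      transpose_mul, transpose_transpose]
  have hpsd : (X ⊗ₖ (-(A * K⁻¹ + K⁻¹ * Aᵀ))).PosSemidef :=
    hX.kronecker (posSemidef_neg_mul_inv_add_inv_mul_transpose hK hKYP)
  convert hpsd using 1
  have ht : ((1 : Matrix (Fin (N - 1)) (Fin (N - 1)) ℝ) ⊗ₖ A - diagonal d ⊗ₖ (B * C))ᵀ =
      1 ⊗ₖ Aᵀ - diagonal d ⊗ₖ (B * C)ᵀ := by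
    rw [transpose_sub, ← kroneckerMap_transpose, ← kroneckerMap_transpose, transpose_one,
      diagonal_transpose]
  rw [ht, Matrix.sub_mul, Matrix.mul_sub]
  simp only [← mul_kronecker_mul, hBC, hBCt, Matrix.one_mul, Matrix.mul_one, ← hXeq]
  ext ⟨i, i'⟩ ⟨j, j'⟩
  simp only [kroneckerMap_apply, Matrix.add_apply, Matrix.sub_apply, Matrix.neg_apply]
  ring
end

section
/- Let A ∈ ℝ^{n×n}, B ∈ ℝ^{n×m}, and let K ∈ ℝ^{n×n} be symmetric positive definite such that AᵀK + KA is negative semidefinite, and set C = BᵀK ∈ ℝ^{m×n}. Let Λ ∈ ℝ^{(N−1)×(N−1)} be a diagonal matrix with positive diagonal entries, let H ∈ ℝ^{q×(N−1)}, and let Y ∈ ℝ^{(N−1)×(N−1)} be symmetric positive semidefinite such that ΛY + YΛ − HᵀH is positive semidefinite. Define Φ = I_{N−1} ⊗ A − Λ ⊗ (BC). Then the matrix Φᵀ(Y ⊗ K) + (Y ⊗ K)Φ + (HᵀH) ⊗ (CᵀC) is negative semidefinite; that is, Y ⊗ K is a generalized observability Gramian of the system (Φ, H ⊗ C). -/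
open Matrix Kronecker

theorem generalized_observability_gramian {n m N q : ℕ}
    (A : Matrix (Fin n) (Fin n) ℝ) (B : Matrix (Fin n) (Fin m) ℝ)
    (K : Matrix (Fin n) (Fin n) ℝ) (hK : K.PosDef)
    (hKYP : (-(Aᵀ * K + K * A)).PosSemidef)
    (C : Matrix (Fin m) (Fin n) ℝ) (hC : C = Bᵀ * K)
    (d : Fin (N - 1) → ℝ) (hd : ∀ i, 0 < d i)
    (H : Matrix (Fin q) (Fin (N - 1)) ℝ)
    (Y : Matrix (Fin (N - 1)) (Fin (N - 1)) ℝ) (hY : Y.PosSemidef)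
    (hYineq : (Matrix.diagonal d * Y + Y * Matrix.diagonal d - Hᵀ * H).PosSemidef) :
    (-(((1 : Matrix (Fin (N - 1)) (Fin (N - 1)) ℝ) ⊗ₖ A - Matrix.diagonal d ⊗ₖ (B * C))ᵀ *
          (Y ⊗ₖ K) +
        (Y ⊗ₖ K) *
          ((1 : Matrix (Fin (N - 1)) (Fin (N - 1)) ℝ) ⊗ₖ A - Matrix.diagonal d ⊗ₖ (B * C)) +
        (Hᵀ * H) ⊗ₖ (Cᵀ * C))).PosSemidef := by
  have hKB : K * B = Cᵀ := by
    have hKt : Kᵀ = K := by simpa using hK.isHermitian.eq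
    rw [hC, transpose_mul, transpose_transpose, hKt]
  have hleft : (B * C)ᵀ * K = Cᵀ * C := by
    rw [transpose_mul, Matrix.mul_assoc, ← hC]
  have hright : K * (B * C) = Cᵀ * C := by
    rw [← Matrix.mul_assoc, hKB]
  have hCC : (Cᵀ * C).PosSemidef := by
    simpa using posSemidef_conjTranspose_mul_self C
  refine (congrArg Matrix.PosSemidef ?_).mpr ((hY.kronecker hKYP).add (hYineq.kronecker hCC))
  simp only [transpose_sub, ← kroneckerMap_transpose, transpose_one, diagonal_transpose,
    Matrix.sub_mul, Matrix.mul_sub, ← mul_kronecker_mul, hleft, hright, Matrix.one_mul,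
    Matrix.mul_one]
  ext i j
  simp only [kroneckerMap_apply, Matrix.neg_apply, Matrix.add_apply, Matrix.sub_apply]
  ring
end

section
/- Let X and Y be real symmetric positive definite n×n matrices. Then there exist an invertible real matrix T and a diagonal real matrix Σ with positive diagonal entries such that T X Tᵀ = Σ and (T⁻¹)ᵀ Y T⁻¹ = Σ. Moreover, the diagonal entries σ₁, …, σₙ of Σ satisfy that σ₁², …, σₙ² are exactly the eigenvalues of the matrix product XY, counted with multiplicity. -/
open Matrix Polynomial

/-- A real positive definite matrix is orthogonally diagonalizable with positive eigenvalues. -/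
theorem Matrix.PosDef.exists_orthogonal_diagonalization {ι : Type*} [Fintype ι] [DecidableEq ι]
    {A : Matrix ι ι ℝ} (hA : A.PosDef) :
    ∃ (V : Matrix ι ι ℝ) (d : ι → ℝ), (∀ i, 0 < d i) ∧ Vᵀ * V = 1 ∧
      A = V * diagonal d * Vᵀ := by
  refine ⟨hA.1.eigenvectorUnitary, hA.1.eigenvalues, hA.eigenvalues_pos, ?_, ?_⟩
  · have h := Unitary.coe_star_mul_self hA.1.eigenvectorUnitary
    rwa [star_eq_conjTranspose, conjTranspose_eq_transpose_of_trivial] at h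
  · have h := hA.1.spectral_theorem
    rw [Unitary.conjStarAlgAut_apply, star_eq_conjTranspose,
      conjTranspose_eq_transpose_of_trivial] at h
    exact h

/-- A real positive definite matrix factors as `L * Lᵀ` with `L` invertible. -/
theorem Matrix.PosDef.exists_isUnit_eq_mul_transpose {ι : Type*} [Fintype ι] [DecidableEq ι]
    {A : Matrix ι ι ℝ} (hA : A.PosDef) :
    ∃ L : Matrix ι ι ℝ, IsUnit L ∧ A = L * Lᵀ := by
  obtain ⟨V, d, hd, -, hAV⟩ := hA.exists_orthogonal_diagonalization
  have h : A = (V * diagonal fun i => √(d i)) * (V * diagonal fun i => √(d i))ᵀ := by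
    have hs : diagonal d = (diagonal fun i => √(d i)) * diagonal fun i => √(d i) := by
      simp [diagonal_mul_diagonal, Real.mul_self_sqrt (hd _).le]
    rw [hAV, hs, transpose_mul, diagonal_transpose]
    simp only [Matrix.mul_assoc]
  refine ⟨_, ?_, h⟩
  have hu := hA.isUnit
  rw [h] at hu
  exact isUnit_of_mul_isUnit_left hu

theorem exists_balancing_transformation {n : ℕ}
    (X Y : Matrix (Fin n) (Fin n) ℝ) (hX : X.PosDef) (hY : Y.PosDef) :
    ∃ (T : Matrix (Fin n) (Fin n) ℝ) (σ : Fin n → ℝ), IsUnit T ∧ (∀ i, 0 < σ i) ∧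
      T * X * Tᵀ = Matrix.diagonal σ ∧
      (T⁻¹)ᵀ * Y * T⁻¹ = Matrix.diagonal σ ∧
      (X * Y).charpoly = ∏ i : Fin n, (Polynomial.X - Polynomial.C (σ i ^ 2)) := by
  obtain ⟨L, hL, hXL⟩ := hX.exists_isUnit_eq_mul_transpose
  have hM : (Lᵀ * Y * L).PosDef := by
    have h := hY.conjTranspose_mul_mul_same (B := L) (mulVec_injective_of_isUnit hL)
    rwa [conjTranspose_eq_transpose_of_trivial] at h
  obtain ⟨V, d, hd, hV, hMV⟩ := hM.exists_orthogonal_diagonalization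
  have hσ : ∀ i, 0 < √(d i) := fun i => Real.sqrt_pos.2 (hd i)
  have hr : ∀ i, 0 < √√(d i) := fun i => Real.sqrt_pos.2 (hσ i)
  set R : Matrix (Fin n) (Fin n) ℝ := diagonal fun i => √√(d i) with hR
  set Q : Matrix (Fin n) (Fin n) ℝ := diagonal fun i => (√√(d i))⁻¹ with hQ
  have hRR : R * R = diagonal fun i => √(d i) := by
    simp [hR, diagonal_mul_diagonal, Real.mul_self_sqrt (hσ _).le]
  have hRQ : R * Q = 1 := by
    simp [hR, hQ, diagonal_mul_diagonal, mul_inv_cancel₀ (hr _).ne']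
  have hQdQ : Q * diagonal d * Q = diagonal fun i => √(d i) := by
    rw [hQ, diagonal_mul_diagonal, diagonal_mul_diagonal]
    congr 1
    ext i
    have h1 := Real.mul_self_sqrt (hσ i).le
    have h2 := Real.mul_self_sqrt (hd i).le
    have h3 := (hr i).ne'
    field_simp
    rw [pow_two, h1, h2]
  have hLdet : IsUnit L.det := (isUnit_iff_isUnit_det L).1 hL
  have hTS : (R * Vᵀ * L⁻¹) * (L * V * Q) = 1 := by
    calc (R * Vᵀ * L⁻¹) * (L * V * Q) = R * (Vᵀ * ((L⁻¹ * L) * V)) * Q := by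
          simp only [Matrix.mul_assoc]
      _ = 1 := by rw [nonsing_inv_mul L hLdet, Matrix.one_mul, hV, Matrix.mul_one, hRQ]
  have hinv : (R * Vᵀ * L⁻¹)⁻¹ = L * V * Q := inv_eq_right_inv hTS
  have hTX : (R * Vᵀ * L⁻¹) * X * (R * Vᵀ * L⁻¹)ᵀ = diagonal fun i => √(d i) := by
    calc (R * Vᵀ * L⁻¹) * X * (R * Vᵀ * L⁻¹)ᵀ
        = R * (Vᵀ * ((L⁻¹ * L) * (L⁻¹ * L)ᵀ * V)) * R := by
          rw [hXL]
          simp only [transpose_mul, transpose_transpose, Matrix.mul_assoc, hR, diagonal_transpose]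
      _ = _ := by
          rw [nonsing_inv_mul L hLdet, transpose_one, Matrix.one_mul, Matrix.one_mul, hV,
            Matrix.mul_one, hRR]
  have hTY : (L * V * Q)ᵀ * Y * (L * V * Q) = diagonal fun i => √(d i) := by
    calc (L * V * Q)ᵀ * Y * (L * V * Q) = Q * (Vᵀ * (Lᵀ * Y * L) * V) * Q := by
          simp only [transpose_mul, Matrix.mul_assoc, hQ, diagonal_transpose]
      _ = Q * ((Vᵀ * V) * diagonal d * (Vᵀ * V)) * Q := by
          rw [hMV]
          simp only [Matrix.mul_assoc]
      _ = _ := by rw [hV, Matrix.one_mul, Matrix.mul_one, hQdQ]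
  generalize R * Vᵀ * L⁻¹ = T at hTS hinv hTX
  generalize L * V * Q = S at hTS hinv hTY
  have hST : S * T = 1 := mul_eq_one_comm.1 hTS
  refine ⟨T, fun i => √(d i), .of_mul_eq_one S hTS, hσ, hTX, by rw [hinv, hTY], ?_⟩
  have hconj : T * (X * Y * S) = diagonal fun i => √(d i) ^ 2 := by
    calc T * (X * Y * S) = T * X * (S * T)ᵀ * Y * S := by
          rw [hST, transpose_one, Matrix.mul_one]
          simp only [Matrix.mul_assoc]
      _ = (T * X * Tᵀ) * (Sᵀ * Y * S) := by simp only [transpose_mul, Matrix.mul_assoc]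
      _ = _ := by simp only [hTX, hTY, diagonal_mul_diagonal, pow_two]
  rw [← charpoly_diagonal, ← hconj, charpoly_mul_comm T, Matrix.mul_assoc _ S, hST, Matrix.mul_one]
end

section
/- Let Y and Λ be real symmetric positive definite n×n matrices that commute (YΛ = ΛY), and let V ∈ ℝ^{n×k} have full column rank k. Then VᵀYV is invertible, and every eigenvalue of the k×k matrix (VᵀYV)⁻¹ Vᵀ Y Λ V is real and positive. -/
open Matrix Polynomial

open scoped ComplexOrder MatrixOrder in
/-- A product of two positive definite matrices has the characteristic polynomial of a positive
definite matrix. -/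
theorem Matrix.PosDef.exists_charpoly_mul_eq {𝕜 m : Type*} [RCLike 𝕜] [Fintype m] [DecidableEq m]
    {A B : Matrix m m 𝕜} (hA : A.PosDef) (hB : B.PosDef) :
    ∃ C : Matrix m m 𝕜, C.PosDef ∧ (A * B).charpoly = C.charpoly := by
  obtain ⟨P, rfl⟩ := CStarAlgebra.nonneg_iff_eq_star_mul_self.mp hA.posSemidef.nonneg
  have hP : IsUnit P := by
    have h := (isUnit_iff_isUnit_det _).mp hA.isUnit
    rw [det_mul] at h
    exact (isUnit_iff_isUnit_det _).mpr (isUnit_of_mul_isUnit_right h)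
  refine ⟨P * B * Pᴴ, ?_, by rw [mul_assoc, charpoly_mul_comm, star_eq_conjTranspose]⟩
  exact hB.mul_mul_conjTranspose_same (vecMul_injective_iff_isUnit.mpr hP)

/-- The complex roots of the characteristic polynomial of a product of two real positive definite
matrices are real and positive. -/
theorem Matrix.PosDef.exists_pos_eq_of_isRoot_charpoly_mul {𝕜 m : Type*} [RCLike 𝕜] [Fintype m]
    [DecidableEq m] {A B : Matrix m m ℝ} (hA : A.PosDef) (hB : B.PosDef) {μ : 𝕜}
    (hμ : ((A * B).charpoly.map (algebraMap ℝ 𝕜)).IsRoot μ) : ∃ r : ℝ, 0 < r ∧ μ = r := by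
  obtain ⟨C, hC, h⟩ := hA.exists_charpoly_mul_eq hB
  rw [h, hC.isHermitian.charpoly_eq, Polynomial.map_prod, IsRoot.def, eval_prod,
    Finset.prod_eq_zero_iff] at hμ
  obtain ⟨i, -, hi⟩ := hμ
  exact ⟨_, hC.eigenvalues_pos i, by simpa [sub_eq_zero] using hi⟩

/-- The product of two commuting real positive definite matrices is positive definite. -/
theorem Matrix.PosDef.mul_of_commute {m : Type*} [Fintype m] {A B : Matrix m m ℝ}
    (hA : A.PosDef) (hB : B.PosDef) (h : Commute A B) : (A * B).PosDef := by
  classical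
  have hAB : (A * B).IsHermitian := (hA.isHermitian.commute_iff hB.isHermitian).mp h
  refine hAB.posDef_iff_eigenvalues_pos.mpr fun i ↦ ?_
  obtain ⟨r, hr, hi⟩ := hA.exists_pos_eq_of_isRoot_charpoly_mul hB (μ := hAB.eigenvalues i) (by
    rw [hAB.charpoly_eq, Polynomial.map_prod, IsRoot.def, eval_prod]
    exact Finset.prod_eq_zero (Finset.mem_univ i) (by simp))
  simpa [hi] using hr

theorem Matrix.mulVec_injective_of_rank_eq_card {R m n : Type*} [Field R] [Fintype n]
    {A : Matrix m n R} (h : A.rank = Fintype.card n) : Function.Injective A.mulVec := by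
  rw [mulVec_injective_iff, linearIndependent_iff_card_eq_finrank_span, Set.finrank, ← h,
    rank_eq_finrank_span_cols]

theorem projected_matrix_real_positive_eigenvalues {n k : ℕ}
    (Y Lam : Matrix (Fin n) (Fin n) ℝ)
    (hY : Y.PosDef) (hLam : Lam.PosDef) (hcomm : Y * Lam = Lam * Y)
    (V : Matrix (Fin n) (Fin k) ℝ) (hV : V.rank = k) :
    IsUnit (Vᵀ * Y * V) ∧
      ∀ μ : ℂ,
        (((Vᵀ * Y * V)⁻¹ * (Vᵀ * Y * Lam * V)).charpoly.map (algebraMap ℝ ℂ)).IsRoot μ →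
          μ.im = 0 ∧ 0 < μ.re := by
  have hinj : Function.Injective V.mulVec :=
    mulVec_injective_of_rank_eq_card (by rw [hV, Fintype.card_fin])
  have hVY : (Vᵀ * Y * V).PosDef := by
    simpa only [conjTranspose_eq_transpose_of_trivial] using hY.conjTranspose_mul_mul_same hinj
  have hVYL : (Vᵀ * Y * Lam * V).PosDef := by
    simpa only [conjTranspose_eq_transpose_of_trivial, ← Matrix.mul_assoc] using
      (hY.mul_of_commute hLam hcomm).conjTranspose_mul_mul_same hinj
  refine ⟨hVY.isUnit, fun μ hμ ↦ ?_⟩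
  obtain ⟨r, hr, rfl⟩ := hVY.inv.exists_pos_eq_of_isRoot_charpoly_mul hVYL hμ
  simpa using hr
end

section
/- Let A ∈ ℝ^{n×n}, B ∈ ℝ^{n×m}, C ∈ ℝ^{m×n} and let K ∈ ℝ^{n×n} be a diagonal matrix with positive diagonal entries such that AᵀK + KA is negative semidefinite and C = BᵀK. Fix r ≤ n and partition A = [[A₁₁, A₁₂],[A₂₁, A₂₂]], B = [B₁; B₂], C = [C₁ C₂], K = diag(K₁, K₂) conformally, with A₁₁ ∈ ℝ^{r×r}, B₁ ∈ ℝ^{r×m}, C₁ ∈ ℝ^{m×r}, K₁ ∈ ℝ^{r×r}. Then K₁ is positive definite diagonal, A₁₁ᵀK₁ + K₁A₁₁ is negative semidefinite, and C₁ = B₁ᵀK₁; that is, the truncated system (A₁₁, B₁, C₁) is again passive with storage matrix K₁. -/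
open Matrix

theorem truncation_preserves_passivity {n m r : ℕ} (hr : r ≤ n)
    (A : Matrix (Fin n) (Fin n) ℝ) (B : Matrix (Fin n) (Fin m) ℝ)
    (C : Matrix (Fin m) (Fin n) ℝ)
    (d : Fin n → ℝ) (hd : ∀ i, 0 < d i)
    (hKYP : (-(Aᵀ * Matrix.diagonal d + Matrix.diagonal d * A)).PosSemidef)
    (hC : C = Bᵀ * Matrix.diagonal d) :
    (Matrix.diagonal fun i : Fin r => d (Fin.castLE hr i)).PosDef ∧
      (-((A.submatrix (Fin.castLE hr) (Fin.castLE hr))ᵀ *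
            Matrix.diagonal (fun i : Fin r => d (Fin.castLE hr i)) +
          Matrix.diagonal (fun i : Fin r => d (Fin.castLE hr i)) *
            A.submatrix (Fin.castLE hr) (Fin.castLE hr))).PosSemidef ∧
      C.submatrix id (Fin.castLE hr) =
        (B.submatrix (Fin.castLE hr) id)ᵀ *
          Matrix.diagonal (fun i : Fin r => d (Fin.castLE hr i)) := by
  refine ⟨Matrix.posDef_diagonal_iff.mpr fun i => hd _, ?_, ?_⟩
  · convert hKYP.submatrix (Fin.castLE hr) using 1
    ext i j
    simp [Matrix.mul_diagonal, Matrix.diagonal_mul]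
  · ext i j
    simp [hC, Matrix.mul_diagonal]
end

section
/- Let A ∈ ℝ^{n×n}, B ∈ ℝ^{n×m}, and let K ∈ ℝ^{n×n} be symmetric positive definite with AᵀK + KA negative semidefinite and C = BᵀK. Assume the pair (C, A) is observable in the Hautus sense: for every nonzero complex vector v and complex number μ with Av = μv (A viewed as a complex matrix), Cv ≠ 0. Then for every real λ > 0, the matrix A − λBC is Hurwitz: every complex eigenvalue μ of A − λBC satisfies Re(μ) < 0. -/
open Matrix Polynomial

/-- The real part of the complex quadratic form of a real matrix splits into the real quadratic
forms of the real and imaginary parts of the vector. -/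
theorem Matrix.re_star_dotProduct_map_ofReal_mulVec {n : Type*} [Fintype n]
    (M : Matrix n n ℝ) (v : n → ℂ) :
    (star v ⬝ᵥ (M.map Complex.ofReal *ᵥ v)).re =
      ((fun i => (v i).re) ⬝ᵥ (M *ᵥ fun i => (v i).re)) +
        (fun i => (v i).im) ⬝ᵥ (M *ᵥ fun i => (v i).im) := by
  simp [dotProduct, mulVec, Complex.mul_re, Finset.sum_add_distrib]

theorem Matrix.PosSemidef.re_star_dotProduct_map_ofReal_mulVec_nonneg {n : Type*} [Fintype n]
    {M : Matrix n n ℝ} (hM : M.PosSemidef) (v : n → ℂ) :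
    0 ≤ (star v ⬝ᵥ (M.map Complex.ofReal *ᵥ v)).re := by
  rw [re_star_dotProduct_map_ofReal_mulVec]
  have hx := hM.dotProduct_mulVec_nonneg (fun i => (v i).re)
  have hy := hM.dotProduct_mulVec_nonneg (fun i => (v i).im)
  simp only [star_trivial] at hx hy
  exact add_nonneg hx hy

theorem Matrix.PosDef.re_star_dotProduct_map_ofReal_mulVec_pos {n : Type*} [Fintype n]
    {M : Matrix n n ℝ} (hM : M.PosDef) {v : n → ℂ} (hv : v ≠ 0) :
    0 < (star v ⬝ᵥ (M.map Complex.ofReal *ᵥ v)).re := by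
  rw [re_star_dotProduct_map_ofReal_mulVec]
  have hx := hM.posSemidef.dotProduct_mulVec_nonneg (fun i => (v i).re)
  have hy := hM.posSemidef.dotProduct_mulVec_nonneg (fun i => (v i).im)
  simp only [star_trivial] at hx hy
  by_cases hre : (fun i => (v i).re) = 0
  · have him : (fun i => (v i).im) ≠ 0 := fun him =>
      hv (funext fun i => Complex.ext (congrFun hre i) (congrFun him i))
    have h := hM.dotProduct_mulVec_pos him
    rw [star_trivial] at h
    exact add_pos_of_nonneg_of_pos hx h
  · have h := hM.dotProduct_mulVec_pos hre
    rw [star_trivial] at h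
    exact add_pos_of_pos_of_nonneg h hy

/-- The Lyapunov form of a real matrix at a complex eigenvector. -/
theorem Matrix.star_dotProduct_lyapunov_mulVec {n : Type*} [Fintype n]
    (N K : Matrix n n ℝ) {v : n → ℂ} {μ : ℂ} (h : N.map Complex.ofReal *ᵥ v = μ • v) :
    star v ⬝ᵥ ((Nᵀ * K + K * N).map Complex.ofReal *ᵥ v) =
      ((2 * μ.re : ℝ) : ℂ) * (star v ⬝ᵥ (K.map Complex.ofReal *ᵥ v)) := by
  have hmap : (Nᵀ * K + K * N).map Complex.ofReal =
      (N.map Complex.ofReal)ᴴ * K.map Complex.ofReal +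
        K.map Complex.ofReal * N.map Complex.ofReal := by
    ext i j
    simp [mul_apply]
  rw [hmap, add_mulVec, dotProduct_add, ← mulVec_mulVec, ← mulVec_mulVec, h, mulVec_smul,
    dotProduct_smul, dotProduct_mulVec, ← star_mulVec, h, star_smul, smul_dotProduct,
    smul_eq_mul, smul_eq_mul, ← add_mul]
  congr 1
  rw [add_comm]
  exact Complex.add_conj μ

theorem passive_observable_feedback_hurwitz {n m : ℕ}
    (A : Matrix (Fin n) (Fin n) ℝ) (B : Matrix (Fin n) (Fin m) ℝ)
    (K : Matrix (Fin n) (Fin n) ℝ) (hK : K.PosDef)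
    (hKYP : (-(Aᵀ * K + K * A)).PosSemidef)
    (C : Matrix (Fin m) (Fin n) ℝ) (hC : C = Bᵀ * K)
    (hobs : ∀ (v : Fin n → ℂ) (μ : ℂ), v ≠ 0 →
      (A.map Complex.ofReal) *ᵥ v = μ • v → (C.map Complex.ofReal) *ᵥ v ≠ 0) :
    ∀ lam : ℝ, 0 < lam →
      ∀ μ : ℂ, ((A - lam • (B * C)).charpoly.map (algebraMap ℝ ℂ)).IsRoot μ → μ.re < 0 := by
  intro lam hlam μ hμ
  rw [← charpoly_map, IsRoot.def, eval_charpoly] at hμ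
  obtain ⟨v, hv, hv0⟩ := exists_mulVec_eq_zero_iff.mpr hμ
  have hN : (A - lam • (B * C)).map Complex.ofReal *ᵥ v = μ • v := by
    rw [sub_mulVec, scalar_apply, ← smul_one_eq_diagonal, smul_mulVec, one_mulVec,
      sub_eq_zero] at hv0
    exact hv0.symm
  have hKt : Kᵀ = K := hK.isHermitian
  have hCt : K * B = Cᵀ := by rw [hC, transpose_mul, transpose_transpose, hKt]
  have hlyap : (A - lam • (B * C))ᵀ * K + K * (A - lam • (B * C)) =
      (Aᵀ * K + K * A) - (2 * lam) • (Cᵀ * C) := by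
    have h₁ : (B * C)ᵀ * K = Cᵀ * C := by rw [transpose_mul, Matrix.mul_assoc, ← hC]
    have h₂ : K * (B * C) = Cᵀ * C := by rw [← Matrix.mul_assoc, hCt]
    rw [transpose_sub, transpose_smul, Matrix.sub_mul, Matrix.mul_sub, Matrix.smul_mul,
      Matrix.mul_smul, h₁, h₂, two_mul, add_smul]
    abel
  set w := C.map Complex.ofReal *ᵥ v with hw
  have hform : ((2 * μ.re : ℝ) : ℂ) * (star v ⬝ᵥ (K.map Complex.ofReal *ᵥ v)) =
      -(star v ⬝ᵥ ((-(Aᵀ * K + K * A)).map Complex.ofReal *ᵥ v)) -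
        ((2 * lam : ℝ) : ℂ) * (star w ⬝ᵥ w) := by
    have hmap : ((Aᵀ * K + K * A) - (2 * lam) • (Cᵀ * C)).map Complex.ofReal =
        -(-(Aᵀ * K + K * A)).map Complex.ofReal -
          ((2 * lam : ℝ) : ℂ) • ((C.map Complex.ofReal)ᴴ * C.map Complex.ofReal) := by
      ext i j
      simp [mul_apply]
    rw [← star_dotProduct_lyapunov_mulVec _ K hN, hlyap, hmap, sub_mulVec, neg_mulVec,
      smul_mulVec, ← mulVec_mulVec, dotProduct_sub, dotProduct_neg, dotProduct_smul,
      dotProduct_mulVec _ _ᴴ, ← star_mulVec, smul_eq_mul]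
  have hre := congrArg Complex.re hform
  rw [Complex.re_ofReal_mul, Complex.sub_re, Complex.neg_re, Complex.re_ofReal_mul] at hre
  have hKpos := hK.re_star_dotProduct_map_ofReal_mulVec_pos hv
  have hAnonneg := hKYP.re_star_dotProduct_map_ofReal_mulVec_nonneg v
  have hw0 : w ≠ 0 := by
    intro hw0
    refine hobs v μ hv ?_ hw0
    have hmap : (A - lam • (B * C)).map Complex.ofReal =
        A.map Complex.ofReal - (lam : ℂ) • (B.map Complex.ofReal * C.map Complex.ofReal) := by
      ext i j
      simp [mul_apply]
    rwa [hmap, sub_mulVec, smul_mulVec, ← mulVec_mulVec, ← hw, hw0, mulVec_zero, smul_zero,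
      sub_zero] at hN
  have hwpos : 0 < (star w ⬝ᵥ w).re := by
    open scoped ComplexOrder in
    exact (Complex.pos_iff.mp (dotProduct_star_self_pos_iff.mpr hw0)).1
  by_contra! hμre
  nlinarith [mul_nonneg hμre hKpos.le, mul_pos hlam hwpos]
end
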